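/- For every n : ℕ, every real vector space (or ℝ-module) V, and every function ψ : Fin n → Fin n → Fin n → V, the following element of the exterior algebra Λ(V) over ℝ vanishes: ∑_{a₁,a₂,a₃,b₁,b₂,b₃,c₁,c₂,c₃ : Fin n} ι(ψ a₁ b₁ c₁) * ι(ψ a₁ b₂ c₂) * ι(ψ a₂ b₂ c₁) * ι(ψ a₂ b₃ c₃) * ι(ψ a₃ b₃ c₂) * ι(ψ a₃ b₁ c₃) = 0, where ι : V → Λ(V) is the canonical inclusion and * is the exterior (wedge) product. -/

import Mathlib

open ExteriorAlgebra

theorem ExteriorAlgebra.ι_mul_six_reverse {R M : Type*} [CommRing R] [AddCommGroup M] [Module R M]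
    (v₁ v₂ v₃ v₄ v₅ v₆ : M) :
    ι R v₆ * ι R v₅ * ι R v₄ * ι R v₃ * ι R v₂ * ι R v₁ =
      -(ι R v₁ * ι R v₂ * ι R v₃ * ι R v₄ * ι R v₅ * ι R v₆) := by
  have h := (ιMulti R 6).map_perm ![v₁, v₂, v₃, v₄, v₅, v₆] Fin.revPerm
  have hs : Equiv.Perm.sign (Fin.revPerm : Equiv.Perm (Fin 6)) = -1 := by decide
  have hv : ![v₁, v₂, v₃, v₄, v₅, v₆] ∘ Fin.revPerm = ![v₆, v₅, v₄, v₃, v₂, v₁] := by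
    funext i
    fin_cases i <;> rfl
  rw [hs, hv] at h
  simpa [ιMulti_apply, List.ofFn_succ, mul_assoc] using h

theorem Finset.sum_comm_reverse₃ {α M : Type*} [Fintype α] [AddCommMonoid M] (f : α → α → α → M) :
    ∑ x, ∑ y, ∑ z, f x y z = ∑ x, ∑ y, ∑ z, f z y x := by
  calc
    ∑ x, ∑ y, ∑ z, f x y z = ∑ x, ∑ z, ∑ y, f x y z :=
      Finset.sum_congr rfl fun _ _ => Finset.sum_comm
    _ = ∑ z, ∑ x, ∑ y, f x y z := Finset.sum_comm
    _ = ∑ z, ∑ y, ∑ x, f x y z := Finset.sum_congr rfl fun _ _ => Finset.sum_comm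

/-- The prism interaction of a single real (Majorana) fermionic rank-3
tensor vanishes identically in the exterior (Grassmann) algebra. -/
theorem prism_interaction_vanishes_for_majorana
    (n : ℕ) (V : Type*) [AddCommGroup V] [Module ℝ V]
    (ψ : Fin n → Fin n → Fin n → V) :
    ∑ a₁ : Fin n, ∑ a₂ : Fin n, ∑ a₃ : Fin n,
      ∑ b₁ : Fin n, ∑ b₂ : Fin n, ∑ b₃ : Fin n,
        ∑ c₁ : Fin n, ∑ c₂ : Fin n, ∑ c₃ : Fin n,
          ι ℝ (ψ a₁ b₁ c₁) * ι ℝ (ψ a₁ b₂ c₂) * ι ℝ (ψ a₂ b₂ c₁) *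
            ι ℝ (ψ a₂ b₃ c₃) * ι ℝ (ψ a₃ b₃ c₂) * ι ℝ (ψ a₃ b₁ c₃)
      = (0 : ExteriorAlgebra ℝ V) := by
  have : IsAddTorsionFree (ExteriorAlgebra ℝ V) := .of_isTorsionFree ℝ _
  rw [← self_eq_neg]
  conv_lhs => rw [Finset.sum_comm_reverse₃]
  simp only [← Finset.sum_neg_distrib]
  refine Finset.sum_congr rfl fun a₁ _ => Finset.sum_congr rfl fun a₂ _ =>
    Finset.sum_congr rfl fun a₃ _ => Finset.sum_congr rfl fun b₁ _ => ?_
  rw [Finset.sum_comm]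
  refine Finset.sum_congr rfl fun b₂ _ => Finset.sum_congr rfl fun b₃ _ => ?_
  rw [Finset.sum_comm_reverse₃]
  exact Finset.sum_congr rfl fun c₁ _ => Finset.sum_congr rfl fun c₂ _ =>
    Finset.sum_congr rfl fun c₃ _ => ExteriorAlgebra.ι_mul_six_reverse ..
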